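/- Let ψ be a 𝕂G-irrep and let α be an automorphism of a field containing ℚ[ψ]. Then the function G → 𝕂 given by g ↦ α(ψ(g)) is the character of some 𝕂G-irrep. -/

import Mathlib

open scoped Classical

noncomputable section

namespace Genotype

variable {k : Type} [Field k] {G : Type} [Group G]

/-- The subfield generated (over the prime field `ℚ`) by the values of a function,
e.g. the field `ℚ[ψ]` generated by the values of a character. -/
def charField {X : Type} {k : Type} [Field k] (f : X → k) : Subfield k :=
  Subfield.closure (Set.range f)

theorem mem_charField {X : Type} {k : Type} [Field k] (f : X → k) (x : X) :
    f x ∈ charField f :=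
  Subfield.subset_closure ⟨x, rfl⟩

/-- Two functions (typically characters of irreps over possibly different
characteristic-zero fields) are Galois conjugate: there is a Galois extension `M` of `ℚ`
containing (copies of) all their values and a field automorphism `α` of `M` with
`α (f g) = f' g` for all `g`. -/
def IsGaloisConj {k l : Type} [Field k] [Field l] {G : Type}
    (f : G → k) (f' : G → l) : Prop :=
  ∃ (M : Type) (_ : Field M) (_ : Algebra ℚ M), IsGalois ℚ M ∧
    ∃ (i : charField f →+* M) (j : charField f' →+* M) (α : M ≃+* M),
      ∀ g : G, α (i ⟨f g, mem_charField f g⟩) = j ⟨f' g, mem_charField f' g⟩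

/-- Irreducibility of a finite-dimensional representation. -/
def IsIrr (V : FDRep k G) : Prop :=
  Nontrivial V ∧
    ∀ U : Submodule k V, (∀ g : G, ∀ x ∈ U, V.ρ g x ∈ U) → U = ⊥ ∨ U = ⊤

/-- Faithfulness of a representation. -/
def IsFaithfulRep (V : FDRep k G) : Prop := Function.Injective V.ρ

/-- `f` (the character of an irrep) occurs in the character `c`,
i.e. `c = f + (character of some representation)`. -/
def CharOccurs (f c : G → k) : Prop :=
  ∃ W : FDRep k G, c = f + W.character

/-- `f` (the character of an irrep) occurs in `c` with multiplicity exactly `m`. -/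
def CharMult (f c : G → k) (m : ℕ) : Prop :=
  ∃ W : FDRep k G, c = m • f + W.character ∧ ¬ CharOccurs f W.character

/-- `f` is the character of an irreducible representation. -/
def IsIrrChar (f : G → k) : Prop := ∃ V : FDRep k G, IsIrr V ∧ f = V.character

/-- Restriction of a character to a subgroup. -/
def resChar (H : Subgroup G) (c : G → k) : H → k := fun h => c h

/-- The induced character `ind_H^G f`. -/
def indChar (H : Subgroup G) (f : H → k) : G → k := fun g =>
  (Nat.card H : k)⁻¹ *
    ∑ᶠ x : G, if h : x⁻¹ * g * x ∈ H then f ⟨x⁻¹ * g * x, h⟩ else 0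

/-- The character `cψ` (of a `kG`-irrep) is tightly induced from the character `cφ`
(of a `kH`-irrep): `cψ` is the induced character of `cφ`, `cφ` occurs with multiplicity
exactly `1` in the restriction of `cψ`, and no Galois conjugate of `cφ` other than `cφ`
itself occurs in the restriction of `cψ`. -/
def TightInd (H : Subgroup G) (cψ : G → k) (cφ : H → k) : Prop :=
  cψ = indChar H cφ ∧ CharMult cφ (resChar H cψ) 1 ∧
    ∀ cφ' : H → k, IsIrrChar cφ' → IsGaloisConj cφ cφ' →
      CharOccurs cφ' (resChar H cψ) → cφ' = cφ

/-- Tight induction from a subquotient `H/K` of `G`: tight induction from `H`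
of the inflation. -/
def TightIndSub (H : Subgroup G) (K : Subgroup H) [K.Normal]
    (cψ : G → k) (cφ : (H ⧸ K) → k) : Prop :=
  TightInd H cψ (fun h => cφ (QuotientGroup.mk h))

/-- A group is Roquette if every normal abelian subgroup of it is cyclic. -/
def IsRoquette (P : Type) [Group P] : Prop :=
  ∀ A : Subgroup P, A.Normal → (∀ x ∈ A, ∀ y ∈ A, x * y = y * x) → IsCyclic A

/-- `χ` is the rational form `ψ_ℚ` of `V`: a rational irrep such that `V` occurs in the
scalar extension `k ⊗_ℚ χ`. -/
def IsRatForm [CharZero k] (χ : FDRep ℚ G) (V : FDRep k G) : Prop :=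
  IsIrr χ ∧ CharOccurs V.character (fun g => algebraMap ℚ k (χ.character g))

/-- Irreps over possibly different characteristic-zero fields are quasiconjugate if they
determine the same rational irrep. -/
def Quasiconj {k l : Type} [Field k] [Field l] [CharZero k] [CharZero l] {G : Type} [Group G]
    (V : FDRep k G) (W : FDRep l G) : Prop :=
  ∃ χ : FDRep ℚ G, IsRatForm χ V ∧ IsRatForm χ W

end Genotype

namespace Genotype

open Polynomial in
/-- eigenbasis data of a finite order matrix -/
theorem exists_eigen {K : Type} [Field K] [IsAlgClosed K] [CharZero K] {ι : Type} [Fintype ι]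
    [DecidableEq ι] (A : Matrix ι ι K) (n : ℕ) (hn : 0 < n) (hA : A ^ n = 1) :
    ∃ (J : Type) (_ : Fintype J) (μ : J → K), (∀ j, μ j ^ n = 1) ∧
      A.charpoly = ∏ j, (X - C (μ j)) ∧ ∀ s, (A ^ s).trace = ∑ j, μ j ^ s := by
  let f : Module.End K (ι → K) := Matrix.toLin' A
  have hpow : ∀ s, Matrix.toLin' (A ^ s) = f ^ s := fun s => Matrix.toLin'_pow A s
  have hf : f ^ n = 1 := by rw [← hpow, hA]; exact Matrix.toLin'_one
  have hss : f.IsSemisimple := by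
    refine Module.End.isSemisimple_of_squarefree_aeval_eq_zero (p := X ^ n - 1) ?_ ?_
    · refine Polynomial.Separable.squarefree ?_
      exact Polynomial.separable_X_pow_sub_C (1 : K) (by exact_mod_cast hn.ne') one_ne_zero
    · simp [hf]
  have htop := hss.iSup_eigenspace_eq_top
  have hint := DirectSum.isInternal_submodule_of_iSupIndep_of_iSup_eq_top
    f.eigenspaces_iSupIndep htop
  let b := hint.collectedBasis (fun μ => Module.finBasis K (f.eigenspace μ))
  have hfin : Finite (Σ μ : K, Fin (Module.finrank K (f.eigenspace μ))) :=
    Module.Finite.finite_basis b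
  let J' := (Σ μ : K, Fin (Module.finrank K (f.eigenspace μ)))
  have : Fintype J' := Fintype.ofFinite _
  have hb : ∀ j : J', f (b j) = j.1 • b j := by
    intro j
    have := hint.collectedBasis_mem (fun μ => Module.finBasis K (f.eigenspace μ)) j
    exact Module.End.mem_eigenspace_iff.1 this
  have hbs : ∀ s, ∀ j : J', (f ^ s) (b j) = j.1 ^ s • b j := by
    intro s j
    induction s with
    | zero => simp
    | succ s ih => rw [pow_succ', Module.End.mul_apply, ih, map_smul, hb, smul_smul, pow_succ]
  have hmat : ∀ s, LinearMap.toMatrix b b (f ^ s) = Matrix.diagonal (fun j : J' => j.1 ^ s) := by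
    intro s
    ext i j
    rw [LinearMap.toMatrix_apply, hbs]
    by_cases h : i = j
    · subst h; simp
    · simp [h]
  refine ⟨J', inferInstance, fun j => j.1, ?_, ?_, ?_⟩
  · intro j
    have h1 := hbs n j
    rw [hf, Module.End.one_apply] at h1
    have h2 : ((j.1 ^ n) - 1) • b j = 0 := by rw [sub_smul, one_smul, ← h1, sub_self]
    rcases smul_eq_zero.1 h2 with h | h
    · exact sub_eq_zero.1 h
    · exact absurd h (b.ne_zero j)
  · have h1 : A.charpoly = f.charpoly := by
      rw [← LinearMap.charpoly_toMatrix f (Pi.basisFun K ι)]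
      congr 1
      exact (LinearMap.toMatrix'_toLin' A).symm
    have h2 := hmat 1
    simp only [pow_one] at h2
    rw [h1, ← LinearMap.charpoly_toMatrix f b, h2, Matrix.charpoly_diagonal]
  · intro s
    have h1 : (A ^ s).trace = LinearMap.trace K _ (f ^ s) := by
      rw [← hpow, Matrix.trace_toLin'_eq]
    rw [h1, LinearMap.trace_eq_matrix_trace K b, hmat, Matrix.trace_diagonal]

/-- sum of principal minors -/
def minors {R : Type} [CommRing R] {ι : Type} [Fintype ι] [DecidableEq ι] (A : Matrix ι ι R) (j : ℕ) : R :=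
  ∑ s ∈ Finset.univ.powersetCard j,
      (A.submatrix (Subtype.val : s → ι) (Subtype.val : s → ι)).det

theorem minors_map {R S : Type} [CommRing R] [CommRing S] {ι : Type} [Fintype ι] [DecidableEq ι] (φ : R →+* S)
    (A : Matrix ι ι R) (j : ℕ) : minors (A.map φ) j = φ (minors A j) := by
  unfold minors
  rw [map_sum]
  refine Finset.sum_congr rfl fun s _ => ?_
  rw [RingHom.map_det]
  rfl

theorem minors_diagonal {R : Type} [CommRing R] {ι : Type} [Fintype ι] [DecidableEq ι] (μ : ι → R) (j : ℕ) :
    minors (Matrix.diagonal μ) j = MvPolynomial.aeval μ (MvPolynomial.esymm ι ℤ j) := by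
  unfold minors
  rw [MvPolynomial.aeval_esymm_eq_multiset_esymm, Finset.esymm_map_val]
  refine Finset.sum_congr rfl fun s _ => ?_
  rw [Matrix.submatrix_diagonal _ _ Subtype.val_injective, Matrix.det_diagonal]
  exact Finset.prod_coe_sort s μ

theorem minors_eq_of_charpoly {R : Type} [Field R] {ι J : Type} [Fintype ι] [DecidableEq ι] [Fintype J] [DecidableEq J]
    (A : Matrix ι ι R) (B : Matrix J J R) (h : A.charpoly = B.charpoly) (j : ℕ) :
    minors A j = minors B j := by
  have hc : Fintype.card ι = Fintype.card J := by
    rw [← A.charpoly_natDegree_eq_dim, ← B.charpoly_natDegree_eq_dim, h]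
  by_cases hj : j ≤ Fintype.card ι
  · have h1 := A.charpoly_coeff_eq_sum_minors j hj
    have h2 := B.charpoly_coeff_eq_sum_minors j (hc ▸ hj)
    rw [h, hc, h2] at h1
    have h3 : ((-1 : R) ^ j) ≠ 0 := pow_ne_zero _ (neg_ne_zero.2 one_ne_zero)
    exact (mul_left_cancel₀ h3 h1).symm
  · unfold minors
    rw [Finset.powersetCard_eq_empty.2 (by simpa using hj),
      Finset.powersetCard_eq_empty.2 (by simpa [← hc] using hj)]
    simp

theorem newton_trace_aux {k K : Type} [Field k] [Field K] [IsAlgClosed K] [CharZero K] (φ : k →+* K) {ι : Type} [Fintype ι] [DecidableEq ι] (A : Matrix ι ι k)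
    (n : ℕ) (hn : 0 < n) (hA : A ^ n = 1) (s : ℕ) (hs : 0 < s) :
    (A ^ s).trace = (-1) ^ (s + 1) * s * minors A s -
      ∑ a ∈ Finset.HasAntidiagonal.antidiagonal s with a.1 ∈ Set.Ioo 0 s,
        (-1) ^ a.1 * minors A a.1 * (A ^ a.2).trace := by
  apply φ.injective
  have hAφ : (A.map φ) ^ n = 1 := by
    rw [← Matrix.map_pow, hA]; simp
  obtain ⟨J, _, μ, -, hchar, htr⟩ := exists_eigen (A.map φ) n hn hAφ
  have hm : ∀ j, φ (minors A j) = MvPolynomial.aeval μ (MvPolynomial.esymm J ℤ j) := by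
    intro j
    rw [← minors_map, ← minors_diagonal]
    apply minors_eq_of_charpoly
    rw [hchar, Matrix.charpoly_diagonal]
  have ht : ∀ j, φ ((A ^ j).trace) = MvPolynomial.aeval μ (MvPolynomial.psum J ℤ j) := by
    intro j
    rw [MvPolynomial.psum, map_sum]
    simp only [map_pow, MvPolynomial.aeval_X]
    rw [← htr, ← Matrix.map_pow]
    exact AddMonoidHom.map_trace φ.toAddMonoidHom _
  simp only [map_sub, map_sum, map_mul, map_pow, map_neg, map_one, map_natCast, hm, ht]
  rw [MvPolynomial.psum_eq_mul_esymm_sub_sum J ℤ s hs]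
  simp only [map_sub, map_sum, map_mul, map_pow, map_neg, map_one, map_natCast]

theorem newton_trace {k : Type} [Field k] [CharZero k] {ι : Type} [Fintype ι] [DecidableEq ι] (A : Matrix ι ι k)
    (n : ℕ) (hn : 0 < n) (hA : A ^ n = 1) (s : ℕ) (hs : 0 < s) :
    (A ^ s).trace = (-1) ^ (s + 1) * s * minors A s -
      ∑ a ∈ Finset.HasAntidiagonal.antidiagonal s with a.1 ∈ Set.Ioo 0 s,
        (-1) ^ a.1 * minors A a.1 * (A ^ a.2).trace := by
  have : CharZero (AlgebraicClosure k) :=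
    charZero_of_injective_algebraMap (algebraMap k (AlgebraicClosure k)).injective
  exact newton_trace_aux (algebraMap k (AlgebraicClosure k)) A n hn hA s hs

open Module in
/-- exterior power of a representation -/
def extRep {k G V : Type} [Field k] [Group G] [AddCommGroup V] [Module k V]
    (ρ : Representation k G V) (j : ℕ) : Representation k G (⋀[k]^j V) where
  toFun g := exteriorPower.map j (ρ g)
  map_one' := by rw [map_one]; exact exteriorPower.map_id
  map_mul' g h := by
    rw [map_mul]
    exact (exteriorPower.map_comp (n := j) (ρ h) (ρ g))

open Module in
theorem trace_extPower {k V : Type} [Field k] [AddCommGroup V] [Module k V] {d : ℕ}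
    (b : Basis (Fin d) k V) (f : V →ₗ[k] V) (j : ℕ) :
    LinearMap.trace k _ (exteriorPower.map j f) = minors (LinearMap.toMatrix b b f) j := by
  rw [LinearMap.trace_eq_matrix_trace k (b.exteriorPower j)]
  unfold minors Matrix.trace
  symm
  refine Finset.sum_bij' (fun s hs => (⟨s, (Finset.mem_powersetCard.1 hs).2⟩ : Set.powersetCard (Fin d) j))
    (fun s _ => s.1) ?_ ?_ ?_ ?_ ?_
  · intros; simp
  · intro s _
    rw [Finset.mem_powersetCard]
    exact ⟨Finset.subset_univ _, s.2⟩
  · intros; rfl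
  · intros; rfl
  · intro s hs
    have hc := (Finset.mem_powersetCard.1 hs).2
    rw [Matrix.diag_apply, LinearMap.toMatrix_apply, exteriorPower.basis_apply,
      exteriorPower.basis_repr_apply, exteriorPower.map_apply_ιMulti_family,
      exteriorPower.ιMulti_family, exteriorPower.ιMultiDual_apply_ιMulti]
    refine (Matrix.det_submatrix_equiv_self (s.orderIsoOfFin hc).toEquiv _).symm.trans ?_
    refine (Matrix.det_transpose _).symm.trans ?_
    congr 1
    ext a c
    simp only [Matrix.transpose_apply, Matrix.submatrix_apply, LinearMap.toMatrix_apply,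
      Matrix.of_apply, Basis.coord_apply, Function.comp_apply,
      Set.powersetCard.ofFinEmbEquiv_symm_apply]
    rfl

open Module in
theorem trace_eq_add {k V : Type} [Field k] [AddCommGroup V] [Module k V]
    [FiniteDimensional k V] (W : Submodule k V) (e : V →ₗ[k] V) (he : W ≤ W.comap e) :
    LinearMap.trace k V e = LinearMap.trace k W (e.restrict he)
      + LinearMap.trace k (V ⧸ W) (W.mapQ W e he) := by
  let bW := Module.Free.chooseBasis k W
  let bQ := Module.Free.chooseBasis k (V ⧸ W)
  let b := Basis.sumQuot bW bQ
  rw [LinearMap.trace_eq_matrix_trace k b, LinearMap.trace_eq_matrix_trace k bW,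
    LinearMap.trace_eq_matrix_trace k bQ]
  unfold Matrix.trace
  rw [Fintype.sum_sum_type]
  congr 1
  · refine Finset.sum_congr rfl fun i _ => ?_
    simp only [b, Basis.sumQuot_inl, Matrix.diag_apply, LinearMap.toMatrix_apply]
    apply Basis.sumQuot_repr_inl_of_mem
  · refine Finset.sum_congr rfl fun l _ => ?_
    simp only [LinearMap.toMatrix_apply, Basis.sumQuot_repr_inr, Matrix.diag_apply, b]
    rw [← Basis.sumQuot_inr bW bQ l, W.mapQ_apply]
    simp

/-- virtual characters -/
def VC (k G : Type) [Field k] [Group G] : AddSubgroup (G → k) :=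
  AddSubgroup.closure {f | IsIrrChar f}

open Module in
theorem char_mem_VC {k G : Type} [Field k] [Group G] : ∀ (n : ℕ) (V : Type) [AddCommGroup V]
    [Module k V] [FiniteDimensional k V] (ρ : Representation k G V), finrank k V = n →
    ρ.character ∈ VC k G := by
  intro n
  induction n using Nat.strong_induction_on with
  | _ n ih =>
  intro V _ _ _ ρ hn
  by_cases hV : Nontrivial V
  swap
  · rw [not_nontrivial_iff_subsingleton] at hV
    have : ρ.character = 0 := by
      ext g
      have : ρ g = 0 := Subsingleton.elim _ _
      simp [Representation.character, this]
    rw [this]; exact zero_mem _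
  by_cases hirr : ∀ U : Submodule k V, (∀ g : G, ∀ x ∈ U, ρ g x ∈ U) → U = ⊥ ∨ U = ⊤
  · exact AddSubgroup.subset_closure ⟨FDRep.of ρ, ⟨hV, hirr⟩, rfl⟩
  · push Not at hirr
    obtain ⟨U, hU, hb, ht⟩ := hirr
    have h1 : ρ.character = (ρ.subrepresentation U hU).character + (ρ.quotient U hU).character := by
      ext g
      exact trace_eq_add U (ρ g) (hU g)
    rw [h1]
    have hlt : finrank k U < n := hn ▸ Submodule.finrank_lt ht
    have hpos : 0 < finrank k U := Submodule.one_le_finrank_iff.2 hb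
    have hadd := Submodule.finrank_quotient_add_finrank U
    exact add_mem (ih _ hlt U _ rfl) (ih (finrank k (V ⧸ U)) (by omega) _ _ rfl)

theorem rep_char_mem {k G V : Type} [Field k] [Group G] [AddCommGroup V]
    [Module k V] [FiniteDimensional k V] (ρ : Representation k G V) : ρ.character ∈ VC k G :=
  char_mem_VC _ V ρ rfl

theorem fd_char_mem {k G : Type} [Field k] [Group G] (V : FDRep k G) : V.character ∈ VC k G :=
  rep_char_mem (V := V) V.ρ

theorem mul_mem_VC {k G : Type} [Field k] [Group G] {f h : G → k} (hf : f ∈ VC k G)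
    (hh : h ∈ VC k G) : f * h ∈ VC k G := by
  induction hf using AddSubgroup.closure_induction with
  | zero => rw [zero_mul]; exact zero_mem _
  | add x y _ _ hx hy => rw [add_mul]; exact add_mem hx hy
  | neg x _ hx => rw [neg_mul]; exact neg_mem hx
  | mem f hf =>
    obtain ⟨V, -, rfl⟩ := hf
    induction hh using AddSubgroup.closure_induction with
    | zero => rw [mul_zero]; exact zero_mem _
    | add x y _ _ hx hy => rw [mul_add]; exact add_mem hx hy
    | neg x _ hx => rw [mul_neg]; exact neg_mem hx
    | mem h hh =>
      obtain ⟨W, -, rfl⟩ := hh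
      have := rep_char_mem (Representation.tprod (V := V) (W := W) V.ρ W.ρ)
      rw [Representation.char_tensor] at this
      exact this

open Module in
theorem adams_rep {k G V : Type} [Field k] [CharZero k] [Group G] [Fintype G] [AddCommGroup V]
    [Module k V] [FiniteDimensional k V] (ρ : Representation k G V) (s : ℕ) (hs : 0 < s) :
    (fun g => ρ.character (g ^ s)) ∈ VC k G := by
  induction s using Nat.strong_induction_on with
  | _ s ih =>
  let b := finBasis k V
  have hch : ∀ g t, ρ.character (g ^ t) = ((LinearMap.toMatrix b b (ρ g)) ^ t).trace := by
    intro g t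
    rw [Representation.character, LinearMap.trace_eq_matrix_trace k b, map_pow,
      LinearMap.toMatrix_pow]
  have hpow : ∀ g, (LinearMap.toMatrix b b (ρ g)) ^ (Fintype.card G) = 1 := by
    intro g
    rw [LinearMap.toMatrix_pow, ← map_pow, pow_card_eq_one, map_one, LinearMap.toMatrix_one]
  have key : (fun g => ρ.character (g ^ s)) = ((-1) ^ (s + 1) * (s : ℤ)) • (extRep ρ s).character -
      ∑ a ∈ Finset.HasAntidiagonal.antidiagonal s with a.1 ∈ Set.Ioo 0 s,
        ((-1 : ℤ) ^ a.1) • ((extRep ρ a.1).character * (fun g => ρ.character (g ^ a.2))) := by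
    ext g
    have hm : ∀ j, minors (LinearMap.toMatrix b b (ρ g)) j = (extRep ρ j).character g :=
      fun j => (trace_extPower b (ρ g) j).symm
    rw [hch, newton_trace _ _ Fintype.card_pos (hpow g) s hs]
    simp only [Pi.sub_apply, Finset.sum_apply, Pi.smul_apply, Pi.mul_apply, hm, hch]
    simp only [zsmul_eq_mul]
    push_cast
    simp only [mul_assoc]
  rw [key]
  refine sub_mem (zsmul_mem (rep_char_mem _) _) (sum_mem fun a ha => zsmul_mem ?_ _)
  rw [Finset.mem_filter, Finset.HasAntidiagonal.mem_antidiagonal] at ha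
  obtain ⟨h1, h2, h3⟩ := ha
  exact mul_mem_VC (rep_char_mem _) (ih a.2 (by omega) (by omega))

theorem adams_mem {k G : Type} [Field k] [CharZero k] [Group G] [Fintype G] {f : G → k}
    (hf : f ∈ VC k G) (s : ℕ) (hs : 0 < s) : (fun g => f (g ^ s)) ∈ VC k G := by
  induction hf using AddSubgroup.closure_induction with
  | zero => exact zero_mem _
  | add x y _ _ hx hy => exact add_mem hx hy
  | neg x _ hx => exact neg_mem hx
  | mem f hf =>
    obtain ⟨V, -, rfl⟩ := hf
    exact adams_rep (V := V) V.ρ s hs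

theorem isIrreducible_of_isIrr {k G : Type} [Field k] [Group G] (V : FDRep k G) (h : IsIrr V) :
    Representation.IsIrreducible (V := V) V.ρ := by
  obtain ⟨h1, h2⟩ := h
  refine { exists_pair_ne := ⟨⊥, ⊤, fun e => ?_⟩, eq_bot_or_eq_top := fun U => ?_ }
  · have := congrArg Subrepresentation.toSubmodule e
    exact bot_ne_top (α := Submodule k V) this
  · rcases h2 U.toSubmodule (fun g x hx => U.apply_mem_toSubmodule g hx) with h | h
    · left; exact Subrepresentation.toSubmodule_injective h
    · right; exact Subrepresentation.toSubmodule_injective h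

/-- inner product of class functions -/
def ip {k G : Type} [Field k] [Group G] [Fintype G] (f h : G → k) : k :=
  (Nat.card G : k)⁻¹ * ∑ g : G, f g * h g⁻¹

section ipsec
variable {k G : Type} [Field k] [Group G] [Fintype G]

theorem ip_comm (f h : G → k) : ip f h = ip h f := by
  unfold ip
  congr 1
  refine Fintype.sum_equiv (Equiv.inv G) _ _ fun g => ?_
  simp [mul_comm]

theorem ip_add_left (f f' h : G → k) : ip (f + f') h = ip f h + ip f' h := by
  unfold ip
  simp only [Pi.add_apply, add_mul, Finset.sum_add_distrib, mul_add]

theorem ip_zsmul_left (a : ℤ) (f h : G → k) : ip (a • f) h = a * ip f h := by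
  unfold ip
  simp only [Pi.smul_apply, smul_mul_assoc, ← Finset.smul_sum]
  rw [mul_smul_comm, zsmul_eq_mul]

theorem ip_zsmul_right (a : ℤ) (f h : G → k) : ip f (a • h) = a * ip f h := by
  rw [ip_comm, ip_zsmul_left, ip_comm]

theorem ip_sum_left {ι : Type} (s : Finset ι) (F : ι → G → k) (h : G → k) :
    ip (∑ i ∈ s, F i) h = ∑ i ∈ s, ip (F i) h := by
  induction s using Finset.induction_on with
  | empty => simp [ip]
  | insert a s ha ih => rw [Finset.sum_insert ha, Finset.sum_insert ha, ip_add_left, ih]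

theorem ip_pow (f h : G → k) (t t' : ℕ) (ht : ∀ g : G, (g ^ t) ^ t' = g)
    : ip (fun g => f (g ^ t)) h = ip f (fun g => h (g ^ t')) := by
  unfold ip
  congr 1
  have ht2 : ∀ g : G, (g ^ t') ^ t = g := fun g => by rw [← pow_mul, mul_comm, pow_mul, ht]
  refine Fintype.sum_equiv ⟨fun g => g ^ t, fun g => g ^ t', ht, ht2⟩ _ _ fun g => ?_
  simp only [Equiv.coe_fn_mk]
  rw [← inv_pow, ht]

variable [CharZero k]

theorem ip_irr_ne {f h : G → k} (hf : IsIrrChar f) (hh : IsIrrChar h) (hne : f ≠ h) :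
    ip f h = 0 := by
  obtain ⟨V, hV, rfl⟩ := hf
  obtain ⟨W, hW, rfl⟩ := hh
  have : Invertible (Nat.card G : k) := invertibleOfNonzero (by simp)
  have := isIrreducible_of_isIrr V hV
  have := isIrreducible_of_isIrr W hW
  have he : IsEmpty (Representation.Equiv (V := W) (W := V) W.ρ V.ρ) :=
    ⟨fun e => hne (Representation.char_iso e).symm⟩
  have h1 := Representation.card_inv_mul_sum_char_mul_char_eq_finrank (V := W) (W := V) W.ρ V.ρ
  rw [Module.finrank_zero_of_subsingleton, Nat.cast_zero] at h1
  exact h1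

theorem ip_irr_self {f : G → k} (hf : IsIrrChar f) : ∃ d : ℕ, 0 < d ∧ ip f f = d := by
  obtain ⟨V, hV, rfl⟩ := hf
  have : Invertible (Nat.card G : k) := invertibleOfNonzero (by simp)
  have h1 := Representation.card_inv_mul_sum_char_mul_char_eq_finrank (V := V) (W := V) V.ρ V.ρ
  refine ⟨_, ?_, h1⟩
  have hnt := hV.1
  have : Nontrivial (Representation.IntertwiningMap (V := V) (W := V) V.ρ V.ρ) := by
    refine ⟨1, 0, fun h => ?_⟩
    obtain ⟨x, hx⟩ := exists_ne (0 : V)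
    exact hx (DFunLike.congr_fun h x)
  have : Module.Finite k (Representation.IntertwiningMap (V := V) (W := V) V.ρ V.ρ) :=
    Module.Finite.equiv (Representation.invariantsEquivIntertwiningMap (V := V) (W := V) V.ρ V.ρ)
  exact Module.finrank_pos

theorem VC_decomp {h : G → k} (hh : h ∈ VC k G) :
    ∃ (S : Finset (G → k)) (c : (G → k) → ℤ), (∀ f ∈ S, IsIrrChar f) ∧ h = ∑ f ∈ S, c f • f := by
  rw [VC, ← Submodule.span_int_eq_addSubgroupClosure] at hh
  obtain ⟨c, S, hS, -, h2⟩ := Submodule.mem_span_iff_exists_finset_subset.1 hh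
  exact ⟨S, c, fun f hf => hS hf, h2.symm⟩

theorem ip_sum_irr (S : Finset (G → k)) (c : (G → k) → ℤ) (hS : ∀ f ∈ S, IsIrrChar f)
    (φ : G → k) (hφ : IsIrrChar φ) :
    ip (∑ f ∈ S, c f • f) φ = (if φ ∈ S then c φ else 0 : ℤ) * ip φ φ := by
  rw [ip_sum_left]
  simp only [ip_zsmul_left]
  by_cases h : φ ∈ S
  · rw [Finset.sum_eq_single_of_mem φ h, if_pos h]
    intro f hf hne
    rw [ip_irr_ne (hS f hf) hφ hne, mul_zero]
  · rw [if_neg h, Int.cast_zero, zero_mul]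
    refine Finset.sum_eq_zero fun f hf => ?_
    rw [ip_irr_ne (hS f hf) hφ (fun e => h (e ▸ hf)), mul_zero]

theorem ip_int {h φ : G → k} (hh : h ∈ VC k G) (hφ : IsIrrChar φ) :
    ∃ a : ℤ, ip h φ = a * ip φ φ := by
  obtain ⟨S, c, hS, rfl⟩ := VC_decomp hh
  exact ⟨_, ip_sum_irr S c hS φ hφ⟩

theorem ip_pos {h : G → k} (hh : h ∈ VC k G) : ∃ q : ℕ, ip h h = q ∧ (q = 0 → h = 0) := by
  obtain ⟨S, c, hS, rfl⟩ := VC_decomp hh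
  choose! d hd hd' using fun (f : G → k) (hf : IsIrrChar f) => ip_irr_self hf
  refine ⟨∑ f ∈ S, (c f).natAbs ^ 2 * d f, ?_, fun h0 => ?_⟩
  · rw [ip_sum_left]
    push_cast
    refine Finset.sum_congr rfl fun f hf => ?_
    rw [ip_zsmul_left, ip_comm, ip_sum_irr S c hS f (hS f hf), if_pos hf, hd' f (hS f hf)]
    have : ((c f).natAbs : k) ^ 2 = (c f : k) ^ 2 := by
      have := Int.natAbs_sq (c f)
      have h2 := congrArg (Int.cast : ℤ → k) this
      push_cast at h2
      simpa using h2
    rw [this]; ring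
  · refine Finset.sum_eq_zero fun f hf => ?_
    have := Finset.sum_eq_zero_iff.1 h0 f hf
    rcases Nat.mul_eq_zero.1 this with h | h
    · have : c f = 0 := by simpa using h
      rw [this, zero_smul]
    · exact absurd h (hd f (hS f hf)).ne'

theorem irrChar_one {f : G → k} (hf : IsIrrChar f) : ∃ d : ℕ, 0 < d ∧ f 1 = d := by
  obtain ⟨V, hV, rfl⟩ := hf
  have := hV.1
  exact ⟨_, Module.finrank_pos (R := k) (M := V), V.char_one⟩

theorem irrChar_mem {f : G → k} (hf : IsIrrChar f) : f ∈ VC k G := AddSubgroup.subset_closure hf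

theorem adams_irr {ψ : G → k} (hψ : IsIrrChar ψ) (t t' : ℕ) (h0 : 0 < t) (h0' : 0 < t')
    (ht : ∀ g : G, (g ^ t) ^ t' = g) : IsIrrChar (fun g => ψ (g ^ t)) := by
  set f : G → k := fun g => ψ (g ^ t) with hf
  have ht2 : ∀ g : G, (g ^ t') ^ t = g := fun g => by rw [← pow_mul, mul_comm, pow_mul, ht]
  have hfV : f ∈ VC k G := adams_mem (irrChar_mem hψ) t h0
  obtain ⟨dψ, hdψ, hdψ'⟩ := ip_irr_self hψ
  have hff : ip f f = dψ := by
    rw [hf, ip_pow _ _ t t' ht]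
    simp only [ht2]
    exact hdψ'
  obtain ⟨φ, hφ, hne⟩ : ∃ φ, IsIrrChar φ ∧ ip f φ ≠ 0 := by
    by_contra! hcon
    obtain ⟨S, c, hS, hS'⟩ := VC_decomp hfV
    have : ip f f = 0 := by
      conv_lhs => rw [ip_comm]; arg 1; rw [hS']
      rw [ip_sum_left]
      refine Finset.sum_eq_zero fun x hx => ?_
      rw [ip_zsmul_left, ip_comm, hcon x (hS x hx), mul_zero]
    rw [hff] at this
    exact hdψ.ne' (by exact_mod_cast this)
  obtain ⟨dφ, hdφ, hdφ'⟩ := ip_irr_self hφ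
  obtain ⟨a, ha⟩ := ip_int hfV hφ
  obtain ⟨b, hb⟩ := ip_int (adams_mem (irrChar_mem hφ) t' h0') hψ
  rw [ip_pow _ _ t' t ht2, ip_comm, hdψ'] at hb
  change ip f φ = _ at hb
  rw [hdφ'] at ha
  have hab : a * dφ = b * dψ := by
    have := ha.symm.trans hb
    exact_mod_cast this
  have ha0 : a ≠ 0 := by
    rintro rfl
    apply hne; rw [ha]; simp
  obtain ⟨q, hq, hq0⟩ := ip_pos (h := f + (-a) • φ)
    (add_mem hfV (zsmul_mem (irrChar_mem hφ) _))
  have hq1 : (q : ℤ) = dψ - a * a * dφ := by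
    have : (q : k) = dψ - a * a * dφ := by
      rw [← hq, ip_add_left, ip_comm f, ip_add_left, ip_zsmul_left, ip_zsmul_left, ip_comm φ (_ + _),
        ip_add_left, ip_zsmul_left, ip_comm φ f, hff, ha, hdφ']
      push_cast
      ring
    exact_mod_cast this
  have hab1 : a * a * dφ = a * b * dψ := by rw [mul_assoc, hab, mul_assoc]
  have hdψz : (0 : ℤ) < dψ := by exact_mod_cast hdψ
  have hdφz : (0 : ℤ) < dφ := by exact_mod_cast hdφ
  have hpos : 0 < a * b := by
    have : 0 < a * a * dφ := mul_pos (mul_self_pos.2 ha0) hdφz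
    rw [hab1] at this
    exact (mul_pos_iff_of_pos_right hdψz).1 this
  have hle : a * b ≤ 1 := by
    by_contra! hgt
    have : (q : ℤ) < 0 := by rw [hq1, hab1]; nlinarith
    omega
  have hab2 : a * b = 1 := by omega
  have hz : f + (-a) • φ = 0 := hq0 (by
    have : (q : ℤ) = 0 := by rw [hq1, hab1, hab2]; ring
    exact_mod_cast this)
  have hfa : f = a • φ := by
    rw [neg_smul] at hz
    exact eq_of_sub_eq_zero (by rw [sub_eq_add_neg]; exact hz)
  rcases Int.eq_one_or_neg_one_of_mul_eq_one hab2 with rfl | rfl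
  · rw [hfa, one_smul]; exact hφ
  · exfalso
    obtain ⟨m, hm, hm'⟩ := irrChar_one hψ
    obtain ⟨l, hl, hl'⟩ := irrChar_one hφ
    have h1 := congrFun hfa 1
    simp only [hf, one_pow, hm', neg_smul, one_smul, Pi.neg_apply, hl'] at h1
    have h2 : (m : ℤ) = - (l : ℤ) := by exact_mod_cast h1
    omega

end ipsec

theorem lift_aux (F K M : Type) [Field F] [Field K] [Algebra F K] [Field M] [Algebra F M]
    [IsAlgClosed M] : Nonempty (algebraicClosure F K →ₐ[F] M) :=
  ⟨IsAlgClosed.lift⟩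

theorem eigen_rep {k G : Type} [Field k] [Group G] [Fintype G] (V : FDRep k G)
    {K : Type} [Field K] [IsAlgClosed K] [CharZero K] (φ : k →+* K) (g : G) :
    ∃ (J : Type) (_ : Fintype J) (μ : J → K), (∀ j, μ j ^ Fintype.card G = 1) ∧
      ∀ s, φ (V.character (g ^ s)) = ∑ j, μ j ^ s := by
  let b := Module.finBasis k V
  let A := LinearMap.toMatrix b b (V.ρ g)
  have hA : A ^ Fintype.card G = 1 := by
    rw [LinearMap.toMatrix_pow, ← map_pow, pow_card_eq_one, map_one, LinearMap.toMatrix_one]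
  have hAφ : (A.map φ) ^ Fintype.card G = 1 := by
    rw [← Matrix.map_pow, hA]; simp
  obtain ⟨J, i, μ, h1, -, h3⟩ := exists_eigen (A.map φ) _ Fintype.card_pos hAφ
  refine ⟨J, i, μ, h1, fun s => ?_⟩
  rw [← h3, ← Matrix.map_pow, FDRep.character, LinearMap.trace_eq_matrix_trace k b, map_pow,
    ← LinearMap.toMatrix_pow]
  exact AddMonoidHom.map_trace φ.toAddMonoidHom _

theorem exists_power_aux {k G : Type} [Field k] [Group G] [Fintype G] (V : FDRep k G)
    {K : Type} [Field K] [IsAlgClosed K] [CharZero K] (φ : k →+* K)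
    (M : Type) [Field M] (i : charField V.character →+* M) (α : M ≃+* M) :
    ∃ t t' : ℕ, 0 < t ∧ 0 < t' ∧ (∀ g : G, (g ^ t) ^ t' = g) ∧
      ∀ g : G, α (i ⟨V.character g, mem_charField _ g⟩) =
        i ⟨V.character (g ^ t), mem_charField _ _⟩ := by
  set n := Fintype.card G with hn
  have hn0 : 0 < n := Fintype.card_pos
  have : NeZero n := ⟨hn0.ne'⟩
  let F := charField V.character
  letI : Algebra F K := (φ.comp F.subtype).toAlgebra
  let Mb := AlgebraicClosure M
  let ι : M →+* Mb := algebraMap M (AlgebraicClosure M)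
  letI : Algebra F Mb := (ι.comp i).toAlgebra
  let L := algebraicClosure F K
  have hint : ∀ x : K, x ^ n = 1 → x ∈ L := by
    intro x hx
    rw [mem_algebraicClosure_iff]
    refine IsIntegral.isAlgebraic ?_
    exact IsIntegral.of_pow hn0 (hx ▸ isIntegral_one)
  obtain ⟨e⟩ : Nonempty (L →ₐ[F] Mb) := lift_aux F K Mb
  let αb : Mb →+* Mb := (IsAlgClosure.equivOfEquiv Mb Mb α : Mb ≃+* Mb)
  have hαb : ∀ x, αb (ι x) = ι (α x) := fun x =>
    IsAlgClosure.equivOfEquiv_algebraMap Mb Mb α x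
  have : NeZero (n : K) := ⟨by exact_mod_cast hn0.ne'⟩
  obtain ⟨ζ, hζ⟩ := HasEnoughRootsOfUnity.exists_primitiveRoot K n
  let ζL : L := ⟨ζ, hint ζ hζ.pow_eq_one⟩
  have hζL : IsPrimitiveRoot ζL n :=
    IsPrimitiveRoot.of_map_of_injective (f := L.val) hζ L.val.injective
  have hζM : IsPrimitiveRoot (e ζL) n := hζL.map_of_injective e.injective
  have hζα : IsPrimitiveRoot (αb (e ζL)) n := hζM.map_of_injective αb.injective
  obtain ⟨t, -, htc, ht⟩ := (hζM.isPrimitiveRoot_iff).1 hζα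
  have hroot : ∀ x : L, x ^ n = 1 → αb (e x) = (e x) ^ t := by
    intro x hx
    obtain ⟨j, -, rfl⟩ := hζL.eq_pow_of_pow_eq_one hx
    rw [map_pow, map_pow, ← ht, ← pow_mul, ← pow_mul, mul_comm]
  -- inverse exponent
  obtain ⟨t', ht'0, ht'⟩ : ∃ t' : ℕ, 0 < t' ∧ t * t' ≡ 1 [MOD n] := by
    have h1 := ZMod.coe_mul_inv_eq_one t htc
    refine ⟨((t : ZMod n)⁻¹).val + n, by omega, ?_⟩
    rw [← ZMod.natCast_eq_natCast_iff]
    push_cast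
    rw [ZMod.natCast_self, add_zero, ZMod.natCast_val, ZMod.cast_id, h1]
  have hpow : ∀ g : G, ∀ a b : ℕ, a ≡ b [MOD n] → g ^ a = g ^ b := by
    intro g a b hab
    rw [pow_eq_pow_iff_modEq]
    exact hab.of_dvd (orderOf_dvd_card)
  refine ⟨t + n, t', by omega, ht'0, fun g => ?_, fun g => ?_⟩
  · rw [← pow_mul]
    have := hpow g ((t + n) * t') 1 (by
      refine Nat.ModEq.trans ?_ ht'
      refine Nat.ModEq.mul_right _ ?_
      simp [Nat.ModEq])
    rw [this, pow_one]
  · have hg : g ^ (t + n) = g ^ t := hpow g _ _ (by simp [Nat.ModEq])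
    simp only [hg]
    obtain ⟨J, _, μ, h1, h2⟩ := eigen_rep V φ g
    let ν : J → L := fun j => ⟨μ j, hint _ (h1 j)⟩
    have hν : ∀ j, ν j ^ n = 1 := fun j => Subtype.ext (h1 j)
    have h3 : ∀ s, algebraMap F L ⟨V.character (g ^ s), mem_charField _ _⟩ = ∑ j, ν j ^ s := by
      intro s
      apply L.val.injective
      rw [map_sum]
      exact h2 s
    have h4 : ∀ s, ι (i ⟨V.character (g ^ s), mem_charField _ _⟩) = ∑ j, e (ν j) ^ s := by
      intro s
      have := congrArg e (h3 s)
      rw [e.commutes, map_sum] at this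
      simp only [map_pow] at this
      exact this
    apply ι.injective
    rw [← hαb, h4 t]
    have h5 := h4 1
    simp only [pow_one] at h5
    rw [h5, map_sum]
    exact Finset.sum_congr rfl fun j _ => hroot _ (hν j)

theorem exists_power {k G : Type} [Field k] [CharZero k] [Group G] [Fintype G] (V : FDRep k G)
    (M : Type) [Field M] (i : charField V.character →+* M) (α : M ≃+* M) :
    ∃ t t' : ℕ, 0 < t ∧ 0 < t' ∧ (∀ g : G, (g ^ t) ^ t' = g) ∧
      ∀ g : G, α (i ⟨V.character g, mem_charField _ g⟩) =
        i ⟨V.character (g ^ t), mem_charField _ _⟩ := by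
  have : CharZero (AlgebraicClosure k) :=
    charZero_of_injective_algebraMap (algebraMap k (AlgebraicClosure k)).injective
  exact exists_power_aux V (algebraMap k (AlgebraicClosure k)) M i α

/-- Let `ψ` be a `𝕂G`-irrep and `α` an automorphism of a field `M` containing (a copy of)
`ℚ[ψ]`, via an embedding `i : ℚ[ψ] → M`. Then `g ↦ α (ψ g)` is (the image under `i` of)
the character of some `𝕂G`-irrep `ψ'`; in particular its values lie in `ℚ[ψ]`. -/
theorem galois_conjugate_character_exists (p : ℕ) (hp : p.Prime)
    (G : Type) [Group G] [Fintype G] (hG : IsPGroup p G)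
    (k : Type) [Field k] [CharZero k] (ψ : FDRep k G) (hψ : IsIrr ψ)
    (M : Type) [Field M] (i : charField ψ.character →+* M) (α : M ≃+* M) :
    ∃ ψ' : FDRep k G, IsIrr ψ' ∧
      ∀ g : G, ∃ h : ψ'.character g ∈ charField ψ.character,
        α (i ⟨ψ.character g, mem_charField _ g⟩) = i ⟨ψ'.character g, h⟩ := by
  obtain ⟨t, t', h0, h0', htt, hα⟩ := exists_power ψ M i α
  have hψ' : IsIrrChar ψ.character := ⟨ψ, hψ, rfl⟩
  obtain ⟨ψ', h1, h2⟩ := adams_irr hψ' t t' h0 h0' htt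
  refine ⟨ψ', h1, fun g => ?_⟩
  have h3 : ψ'.character g = ψ.character (g ^ t) := (congrFun h2 g).symm
  have h4 : ψ'.character g ∈ charField ψ.character := h3 ▸ mem_charField _ _
  refine ⟨h4, ?_⟩
  rw [hα]
  congr 2
  exact h3.symm

end Genotype
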